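/- arXiv:1604.05803 — 5 statements merged into one kernel-verified Lean document; each statement's English description precedes it below -/
import Mathlib

section
/- Fix real numbers λ, μ, α > 0 and integers n₀ ≥ 1, k ≥ 2, N = n₀ + k, K ≥ N, and fix i with 1 ≤ i ≤ k−1; write nᵢ = n₀ + i and nᵢ₋₁ = n₀ + i − 1. Let πᵢ₋₁(j) > 0 be given for nᵢ₋₁ ≤ j ≤ K. Define aⁱ(K) = (N−nᵢ₋₁)·α·πᵢ₋₁(K)/((N−nᵢ)·α + nᵢ·μ), bⁱ(K) = λ/((N−nᵢ)·α + nᵢ·μ), and backward for j = K−1, …, nᵢ+1, with Dⱼ = λ + min(N−nᵢ, j−nᵢ)·α + nᵢ·μ − nᵢ·μ·bⁱ(j+1): aⁱ(j) = (nᵢ·μ·aⁱ(j+1) + min(N−nᵢ₋₁, j−nᵢ₋₁)·α·πᵢ₋₁(j))/Dⱼ and bⁱ(j) = λ/Dⱼ. Then: (1) aⁱ(K) > 0 and 0 < bⁱ(K) ≤ λ/(nᵢ·μ + min(K−nᵢ, N−nᵢ)·α); (2) for every j with nᵢ+1 ≤ j ≤ K−1, Dⱼ > nᵢ·μ + min(j−nᵢ,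 N−nᵢ)·α > 0 (so the recursion is well defined), 0 < aⁱ(j) < (nᵢ·μ·aⁱ(j+1) + min(N−nᵢ₋₁, j−nᵢ₋₁)·α·πᵢ₋₁(j))/(nᵢ·μ + min(j−nᵢ, N−nᵢ)·α), and 0 < bⁱ(j) < λ/(nᵢ·μ + min(j−nᵢ, N−nᵢ)·α). -/
/-- Corollary 1 of the paper: positivity and bounds for the coefficients
`aⁱ j`, `bⁱ j` of the level-`i` backward recursion (1 ≤ i ≤ k−1), given positive
level-(i−1) probabilities. In particular the denominators `Dⱼ` are positive, so
the recursion is well defined and numerically stable. -/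
theorem leveli_coefficients_bounds
    (lam mu alpha : ℝ) (hlam : 0 < lam) (hmu : 0 < mu) (halpha : 0 < alpha)
    (n₀ k N K i : ℤ) (hn₀ : 1 ≤ n₀) (hk : 2 ≤ k) (hN : N = n₀ + k) (hK : N ≤ K)
    (hi1 : 1 ≤ i) (hi2 : i ≤ k - 1)
    (piPrev a b : ℤ → ℝ)
    -- positive level-(i−1) probabilities
    (hpiPrev : ∀ j : ℤ, n₀ + i - 1 ≤ j → j ≤ K → 0 < piPrev j)
    -- definition of aⁱ(K), bⁱ(K)
    (haK : a K = ((N - (n₀ + i - 1) : ℤ) : ℝ) * alpha * piPrev K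
      / (((N - (n₀ + i) : ℤ) : ℝ) * alpha + ((n₀ + i : ℤ) : ℝ) * mu))
    (hbK : b K = lam
      / (((N - (n₀ + i) : ℤ) : ℝ) * alpha + ((n₀ + i : ℤ) : ℝ) * mu))
    -- the backward recursion
    (harec : ∀ j : ℤ, n₀ + i + 1 ≤ j → j ≤ K - 1 →
      a j = (((n₀ + i : ℤ) : ℝ) * mu * a (j + 1)
              + (min (N - (n₀ + i - 1)) (j - (n₀ + i - 1)) : ℝ) * alpha * piPrev j)
        / (lam + (min (N - (n₀ + i)) (j - (n₀ + i)) : ℝ) * alpha + ((n₀ + i : ℤ) : ℝ) * mu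
            - ((n₀ + i : ℤ) : ℝ) * mu * b (j + 1)))
    (hbrec : ∀ j : ℤ, n₀ + i + 1 ≤ j → j ≤ K - 1 →
      b j = lam
        / (lam + (min (N - (n₀ + i)) (j - (n₀ + i)) : ℝ) * alpha + ((n₀ + i : ℤ) : ℝ) * mu
            - ((n₀ + i : ℤ) : ℝ) * mu * b (j + 1))) :
    -- (1) bounds at j = K
    (0 < a K ∧ 0 < b K ∧
      b K ≤ lam / (((n₀ + i : ℤ) : ℝ) * mu + (min (K - (n₀ + i)) (N - (n₀ + i)) : ℝ) * alpha))
    ∧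
    -- (2) bounds for nᵢ+1 ≤ j ≤ K−1
    (∀ j : ℤ, n₀ + i + 1 ≤ j → j ≤ K - 1 →
      (0 < ((n₀ + i : ℤ) : ℝ) * mu + (min (j - (n₀ + i)) (N - (n₀ + i)) : ℝ) * alpha) ∧
      (((n₀ + i : ℤ) : ℝ) * mu + (min (j - (n₀ + i)) (N - (n₀ + i)) : ℝ) * alpha
        < lam + (min (N - (n₀ + i)) (j - (n₀ + i)) : ℝ) * alpha + ((n₀ + i : ℤ) : ℝ) * mu
            - ((n₀ + i : ℤ) : ℝ) * mu * b (j + 1)) ∧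
      (0 < a j) ∧
      (a j < (((n₀ + i : ℤ) : ℝ) * mu * a (j + 1)
              + (min (N - (n₀ + i - 1)) (j - (n₀ + i - 1)) : ℝ) * alpha * piPrev j)
        / (((n₀ + i : ℤ) : ℝ) * mu + (min (j - (n₀ + i)) (N - (n₀ + i)) : ℝ) * alpha)) ∧
      (0 < b j) ∧
      (b j < lam
        / (((n₀ + i : ℤ) : ℝ) * mu + (min (j - (n₀ + i)) (N - (n₀ + i)) : ℝ) * alpha))) := by
  have hn : 0 < ((n₀ + i : ℤ) : ℝ) := by exact_mod_cast (by lia : 0 < n₀ + i)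
  have hc : 0 < ((n₀ + i : ℤ) : ℝ) * mu := mul_pos hn hmu
  have hNi : 0 < ((N - (n₀ + i) : ℤ) : ℝ) := by exact_mod_cast (by lia : 0 < N - (n₀ + i))
  have hNi' : 0 < ((N - (n₀ + i - 1) : ℤ) : ℝ) := by
    exact_mod_cast (by lia : 0 < N - (n₀ + i - 1))
  have hden : 0 < ((N - (n₀ + i) : ℤ) : ℝ) * alpha := mul_pos hNi halpha
  have haK_pos : 0 < a K := by
    rw [haK]
    have := hpiPrev K (by lia) le_rfl
    positivity
  have hbK_pos : 0 < b K := by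
    rw [hbK]
    positivity
  have hbK_lt : ((n₀ + i : ℤ) : ℝ) * mu * b K < lam := by
    rw [hbK, ← mul_div_assoc, div_lt_iff₀ (by positivity)]
    nlinarith
  have hmin : ∀ j : ℤ, n₀ + i + 1 ≤ j →
      0 < (min (N - (n₀ + i)) (j - (n₀ + i)) : ℝ) * alpha := by
    intro j hj
    have hj' : ((n₀ : ℝ) + i + 1) ≤ j := by exact_mod_cast hj
    push_cast at hNi
    exact mul_pos (lt_min hNi (by linarith)) halpha
  have hsrc : ∀ j : ℤ, n₀ + i + 1 ≤ j → j ≤ K - 1 →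
      0 < (min (N - (n₀ + i - 1)) (j - (n₀ + i - 1)) : ℝ) * alpha * piPrev j := by
    intro j hj hjK
    have hj' : ((n₀ : ℝ) + i + 1) ≤ j := by exact_mod_cast hj
    push_cast at hNi'
    exact mul_pos (mul_pos (lt_min hNi' (by linarith)) halpha)
      (hpiPrev j (by lia) (by lia))
  have key : ∀ j : ℤ, j ≤ K → n₀ + i + 1 ≤ j →
      0 < a j ∧ 0 < b j ∧ ((n₀ + i : ℤ) : ℝ) * mu * b j < lam := by
    intro j hjK
    induction j, hjK using Int.leInductionDown with
    | base => exact fun _ => ⟨haK_pos, hbK_pos, hbK_lt⟩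
    | pred m hmK ih =>
      intro hm
      obtain ⟨ha, -, hlt⟩ := ih (by lia)
      have hmin_pos := hmin (m - 1) hm
      have hsrc_pos := hsrc (m - 1) hm (by lia)
      rw [harec (m - 1) hm (by lia), hbrec (m - 1) hm (by lia), sub_add_cancel]
      refine ⟨div_pos (add_pos (mul_pos hc ha) hsrc_pos) (by linarith),
        div_pos hlam (by linarith), ?_⟩
      rw [← mul_div_assoc, div_lt_iff₀ (by linarith), mul_comm]
      exact mul_lt_mul_of_pos_left (by linarith) hlam
  refine ⟨⟨haK_pos, hbK_pos, ?_⟩, fun j hj hjK => ?_⟩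
  · have hNK : (N : ℝ) ≤ K := by exact_mod_cast hK
    rw [hbK, min_eq_right (by linarith)]
    push_cast
    rw [add_comm]
  · obtain ⟨ha', -, hlt⟩ := key (j + 1) (by lia) (by lia)
    obtain ⟨ha, hb, -⟩ := key j (by lia) hj
    have hmin_pos := hmin j hj
    have hsrc_pos := hsrc j hj hjK
    rw [min_comm ((j : ℝ) - (n₀ + i))]
    refine ⟨by linarith, by linarith, ha, ?_, hb, ?_⟩
    · rw [harec j hj hjK]
      exact div_lt_div_of_pos_left (add_pos (mul_pos hc ha') hsrc_pos) (by linarith)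
        (by linarith)
    · rw [hbrec j hj hjK]
      exact div_lt_div_of_pos_left hlam (by linarith) (by linarith)
end

section
/- Fix real numbers λ, μ, α > 0 and integers n₀ ≥ 1, k ≥ 1, N = n₀ + k, K ≥ N; write n_k = n₀ + k = N and n_{k−1} = N − 1, so N − n_{k−1} = 1. Let π_{k−1} : {n_{k−1},…,K} → ℝ and π_k : {n_k,…,K} → ℝ satisfy the balance equations: n_k·μ·π_k(K) = α·π_{k−1}(K) + λ·π_k(K−1), and (λ + n_k·μ)·π_k(j) = λ·π_k(j−1) + n_k·μ·π_k(j+1) + α·π_{k−1}(j) for n_k+1 ≤ j ≤ K−1. Define aᵏ(K) = α·π_{k−1}(K)/(n_k·μ), bᵏ(K) = λ/(n_k·μ), and backward for j = K−1, …, n_k+1, with Dⱼ = λ + n_k·μ − n_k·μ·bᵏ(j+1) assumed nonzero: aᵏ(j) = (n_k·μ·aᵏ(j+1) + α·π_{k−1}(j))/Dⱼ and bᵏ(j) = λ/Dⱼ. Then π_k(j) = aᵏ(j) + bᵏ(j)·π_k(j−1) for every n_k+1 ≤ j ≤ K. -/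
/-- Lemma 2 of the paper (top level i = k): backward recursion
`π_k j = aᵏ j + bᵏ j * π_k (j-1)` for the M/M/N/K/setup queue,
where n_k = n₀ + k = N and N − n_{k−1} = 1. -/
theorem levelk_recursion
    (lam mu alpha : ℝ) (hlam : 0 < lam) (hmu : 0 < mu) (halpha : 0 < alpha)
    (n₀ k N K : ℤ) (hn₀ : 1 ≤ n₀) (hk : 1 ≤ k) (hN : N = n₀ + k) (hK : N ≤ K)
    (piPrev piK a b : ℤ → ℝ)
    -- balance equation at state (k, K)
    (hbalK : ((N : ℤ) : ℝ) * mu * piK K = alpha * piPrev K + lam * piK (K - 1))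
    -- balance equations at states (k, j), n_k+1 ≤ j ≤ K−1
    (hbal : ∀ j : ℤ, N + 1 ≤ j → j ≤ K - 1 →
      (lam + ((N : ℤ) : ℝ) * mu) * piK j
        = lam * piK (j - 1) + ((N : ℤ) : ℝ) * mu * piK (j + 1) + alpha * piPrev j)
    -- definition of aᵏ(K), bᵏ(K)
    (haK : a K = alpha * piPrev K / (((N : ℤ) : ℝ) * mu))
    (hbK : b K = lam / (((N : ℤ) : ℝ) * mu))
    -- the backward recursion, with nonzero denominators
    (hden : ∀ j : ℤ, N + 1 ≤ j → j ≤ K - 1 →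
      lam + ((N : ℤ) : ℝ) * mu - ((N : ℤ) : ℝ) * mu * b (j + 1) ≠ 0)
    (harec : ∀ j : ℤ, N + 1 ≤ j → j ≤ K - 1 →
      a j = (((N : ℤ) : ℝ) * mu * a (j + 1) + alpha * piPrev j)
        / (lam + ((N : ℤ) : ℝ) * mu - ((N : ℤ) : ℝ) * mu * b (j + 1)))
    (hbrec : ∀ j : ℤ, N + 1 ≤ j → j ≤ K - 1 →
      b j = lam / (lam + ((N : ℤ) : ℝ) * mu - ((N : ℤ) : ℝ) * mu * b (j + 1))) :
    ∀ j : ℤ, N + 1 ≤ j → j ≤ K → piK j = a j + b j * piK (j - 1) := by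
  have hNmu : (N : ℝ) * mu ≠ 0 := by
    have hNpos : (0 : ℝ) < N := by exact_mod_cast (by omega : 0 < N)
    positivity
  intro j hj hjK
  induction j, hjK using Int.leInductionDown with
  | base =>
    rw [haK, hbK, div_mul_eq_mul_div, ← add_div, eq_div_iff hNmu]
    linear_combination hbalK
  | pred j hjK ih =>
    have hnext := ih (by omega)
    have hjK' : j - 1 ≤ K - 1 := by omega
    have hD := hden (j - 1) hj hjK'
    rw [harec (j - 1) hj hjK', hbrec (j - 1) hj hjK', div_mul_eq_mul_div, ← add_div,
      eq_div_iff hD]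
    have hbal' := hbal (j - 1) hj hjK'
    rw [sub_add_cancel] at hbal' ⊢
    linear_combination hbal' + (N : ℝ) * mu * hnext
end

section
/- Fix real numbers λ, μ, α > 0 and integers n₀ ≥ 1, k ≥ 1, N = n₀ + k, K ≥ N; write n_k = N. Let π_{k−1}(j) > 0 be given for n_{k−1} = N−1 ≤ j ≤ K. Define aᵏ(K) = α·π_{k−1}(K)/(n_k·μ), bᵏ(K) = λ/(n_k·μ), and backward for j = K−1, …, n_k+1, with Dⱼ = λ + n_k·μ − n_k·μ·bᵏ(j+1): aᵏ(j) = (n_k·μ·aᵏ(j+1) + α·π_{k−1}(j))/Dⱼ and bᵏ(j) = λ/Dⱼ. Then for every j with n_k+1 ≤ j ≤ K−1 one has Dⱼ ≥ n_k·μ > 0 (so the recursion is well defined), aᵏ(j) > 0, and 0 < bᵏ(j) ≤ λ/(n_k·μ). -/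
/-- If `b ≤ lam / c` with `0 < c`, the denominator `lam + c - c * b` is at least `c`. -/
lemma le_add_sub_mul_of_le_div {lam c b : ℝ} (hc : 0 < c) (hb : b ≤ lam / c) :
    c ≤ lam + c - c * b := by
  rw [le_div_iff₀' hc] at hb
  linarith

/-- Corollary 2 of the paper: positivity and bounds for the coefficients
`aᵏ j`, `bᵏ j` of the top-level (i = k) backward recursion, given positive
level-(k−1) probabilities; in particular the denominators `Dⱼ` satisfy
`Dⱼ ≥ n_k·μ > 0`, so the recursion is well defined. Here n_k = n₀ + k = N. -/
theorem levelk_coefficients_bounds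
    (lam mu alpha : ℝ) (hlam : 0 < lam) (hmu : 0 < mu) (halpha : 0 < alpha)
    (n₀ k N K : ℤ) (hn₀ : 1 ≤ n₀) (hk : 1 ≤ k) (hN : N = n₀ + k) (hK : N ≤ K)
    (piPrev a b : ℤ → ℝ)
    -- positive level-(k−1) probabilities on [N−1, K]
    (hpiPrev : ∀ j : ℤ, N - 1 ≤ j → j ≤ K → 0 < piPrev j)
    -- definition of aᵏ(K), bᵏ(K)
    (haK : a K = alpha * piPrev K / (((N : ℤ) : ℝ) * mu))
    (hbK : b K = lam / (((N : ℤ) : ℝ) * mu))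
    -- the backward recursion
    (harec : ∀ j : ℤ, N + 1 ≤ j → j ≤ K - 1 →
      a j = (((N : ℤ) : ℝ) * mu * a (j + 1) + alpha * piPrev j)
        / (lam + ((N : ℤ) : ℝ) * mu - ((N : ℤ) : ℝ) * mu * b (j + 1)))
    (hbrec : ∀ j : ℤ, N + 1 ≤ j → j ≤ K - 1 →
      b j = lam / (lam + ((N : ℤ) : ℝ) * mu - ((N : ℤ) : ℝ) * mu * b (j + 1))) :
    ∀ j : ℤ, N + 1 ≤ j → j ≤ K - 1 →
      (0 < ((N : ℤ) : ℝ) * mu) ∧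
      (((N : ℤ) : ℝ) * mu ≤ lam + ((N : ℤ) : ℝ) * mu - ((N : ℤ) : ℝ) * mu * b (j + 1)) ∧
      (0 < a j) ∧
      (0 < b j) ∧
      (b j ≤ lam / (((N : ℤ) : ℝ) * mu)) := by
  have hc : 0 < (N : ℝ) * mu := mul_pos (by exact_mod_cast (by omega : 0 < N)) hmu
  have hbounds : ∀ j : ℤ, j ≤ K → N + 1 ≤ j →
      0 < a j ∧ 0 < b j ∧ b j ≤ lam / ((N : ℝ) * mu) := by
    intro j hj
    induction j, hj using Int.leInductionDown with
    | base =>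
      intro _
      have hpi := hpiPrev K (by omega) le_rfl
      exact ⟨by rw [haK]; positivity, by rw [hbK]; positivity, hbK.le⟩
    | pred j hjK ih =>
      intro hNj
      obtain ⟨ha, -, hb⟩ := ih (by omega)
      have hD := le_add_sub_mul_of_le_div hc hb
      have hD_pos := hc.trans_le hD
      have hpi := hpiPrev (j - 1) (by omega) (by omega)
      have ha_eq := harec (j - 1) hNj (by omega)
      have hb_eq := hbrec (j - 1) hNj (by omega)
      rw [sub_add_cancel] at ha_eq hb_eq
      rw [ha_eq, hb_eq]
      exact ⟨div_pos (add_pos (mul_pos hc ha) (mul_pos halpha hpi)) hD_pos,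
        div_pos hlam hD_pos, div_le_div_of_nonneg_left hlam.le hc hD⟩
  intro j hNj hjK
  obtain ⟨ha, hb, hb_le⟩ := hbounds j (by omega) hNj
  have hb_succ := (hbounds (j + 1) (by omega) (by omega)).2.2
  exact ⟨hc, le_add_sub_mul_of_le_div hc hb_succ, ha, hb, hb_le⟩
end

section
/- Consider the continuous-time Markov chain of the M/M/N/K/setup queue on the state space S = {(0,j) : 0 ≤ j ≤ K} ∪ {(i,j) : 1 ≤ i ≤ k, nᵢ ≤ j ≤ K}, with transition rates: from (i,j) to (i,j+1) at rate λ for j ≤ K−1; from (0,j) to (0,j−1) at rate min(j,n₀)·μ for j ≥ 1; for i ≥ 1, from (i,j) to (i,j−1) at rate nᵢ·μ for j ≥ nᵢ+1, and from (i,nᵢ) to (i−1,nᵢ₋₁) at rate nᵢ·μ; for 0 ≤ i ≤ k−1, from (i,j) to (i+1,j) at rate min(j−nᵢ, N−nᵢ)·α for j ≥ nᵢ+1. Suppose π : S → ℝ satisfies the global balance equation at every state of this chain (the total outflow rate from the state times its probability equals the sum over all states of the inflow rate times that state's probability). Then for every i with 0 ≤ i ≤ k−1, the cut (local balance) equation holds: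 nᵢ₊₁·μ·π(i+1, nᵢ₊₁) = Σ_{j = nᵢ+1}^{K} min(j−nᵢ, N−nᵢ)·α·π(i,j). -/
/-- Balance across a cut: if inflow equals outflow at every point of `S`, then the total flow from
`S.filter p` to its complement in `S` equals the total flow back. -/
theorem Finset.sum_cut_eq_of_balance {V M : Type*} [AddCommGroup M] (S : Finset V) (f : V → V → M)
    (p : V → Prop) [DecidablePred p]
    (h : ∀ s ∈ S, ∑ t ∈ S, f s t = ∑ t ∈ S, f t s) :
    ∑ x ∈ S.filter p ×ˢ S.filter (fun t => ¬ p t), f x.1 x.2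
      = ∑ x ∈ S.filter p ×ˢ S.filter (fun t => ¬ p t), f x.2 x.1 := by
  have hsum : ∑ s ∈ S.filter p, ∑ t ∈ S, f s t = ∑ s ∈ S.filter p, ∑ t ∈ S, f t s :=
    Finset.sum_congr rfl fun s hs => h s (Finset.mem_filter.mp hs).1
  simp only [← Finset.sum_filter_add_sum_filter_not S p (f _),
    ← Finset.sum_filter_add_sum_filter_not S p (fun t => f t _), Finset.sum_add_distrib] at hsum
  rw [Finset.sum_comm (s := S.filter p) (t := S.filter p)] at hsum
  rw [Finset.sum_product, Finset.sum_product]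
  exact add_left_cancel hsum

/-- Local (cut) balance for the M/M/N/K/setup queue: if `π` satisfies the global
balance equation at every state of the chain whose state space is
`S = {(0,j) : 0 ≤ j ≤ K} ∪ {(i,j) : 1 ≤ i ≤ k, n₀+i ≤ j ≤ K}` and whose transition
rates `r` are as stated, then for every `0 ≤ i ≤ k−1`,
`nᵢ₊₁·μ·π(i+1, nᵢ₊₁) = Σ_{j=nᵢ+1}^{K} min(j−nᵢ, N−nᵢ)·α·π(i,j)`. -/
theorem setup_queue_local_balance
    (lam mu alpha : ℝ) (hlam : 0 < lam) (hmu : 0 < mu) (halpha : 0 < alpha)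
    (n₀ k N K : ℤ) (hn₀ : 1 ≤ n₀) (hk : 1 ≤ k) (hN : N = n₀ + k) (hK : N ≤ K)
    (S : Finset (ℤ × ℤ))
    -- the state space
    (hS : S = (Finset.Icc 0 k ×ˢ Finset.Icc 0 K).filter
      (fun s => s.1 = 0 ∨ n₀ + s.1 ≤ s.2))
    (r : ℤ × ℤ → ℤ × ℤ → ℝ)
    -- the transition rates
    (hr : ∀ i j i' j' : ℤ, r (i, j) (i', j') =
      -- arrivals: (i,j) → (i,j+1) at rate λ, for j ≤ K−1
      (if i' = i ∧ j' = j + 1 ∧ j ≤ K - 1 then lam else 0)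
      -- level-0 departures: (0,j) → (0,j−1) at rate min(j,n₀)·μ, for j ≥ 1
      + (if i = 0 ∧ i' = 0 ∧ j' = j - 1 ∧ 1 ≤ j then (min j n₀ : ℝ) * mu else 0)
      -- level-i (i ≥ 1) departures with j ≥ nᵢ+1 : (i,j) → (i,j−1) at rate nᵢ·μ
      + (if 1 ≤ i ∧ i' = i ∧ j' = j - 1 ∧ n₀ + i + 1 ≤ j
          then ((n₀ + i : ℤ) : ℝ) * mu else 0)
      -- level-i (i ≥ 1) departure at the bottom state: (i,nᵢ) → (i−1,nᵢ₋₁) at rate nᵢ·μ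
      + (if 1 ≤ i ∧ i' = i - 1 ∧ j = n₀ + i ∧ j' = n₀ + i - 1
          then ((n₀ + i : ℤ) : ℝ) * mu else 0)
      -- setup completions: (i,j) → (i+1,j) at rate min(j−nᵢ, N−nᵢ)·α,
      -- for 0 ≤ i ≤ k−1 and j ≥ nᵢ+1
      + (if 0 ≤ i ∧ i ≤ k - 1 ∧ i' = i + 1 ∧ j' = j ∧ n₀ + i + 1 ≤ j
          then (min (j - (n₀ + i)) (N - (n₀ + i)) : ℝ) * alpha else 0))
    (piS : ℤ × ℤ → ℝ)
    -- global balance at every state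
    (hbal : ∀ s ∈ S, (∑ t ∈ S, r s t) * piS s = ∑ t ∈ S, r t s * piS t) :
    ∀ i : ℤ, 0 ≤ i → i ≤ k - 1 →
      ((n₀ + i + 1 : ℤ) : ℝ) * mu * piS (i + 1, n₀ + i + 1)
        = ∑ j ∈ Finset.Icc (n₀ + i + 1) K,
            (min (j - (n₀ + i)) (N - (n₀ + i)) : ℝ) * alpha * piS (i, j) := by
  intro i hi hik
  have hcut := Finset.sum_cut_eq_of_balance S (fun s t => r s t * piS s) (fun s => s.1 ≤ i)
    (fun s hs => by rw [← Finset.sum_mul]; exact hbal s hs)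
  have hup : ∑ j ∈ Finset.Icc (n₀ + i + 1) K,
      (min (j - (n₀ + i)) (N - (n₀ + i)) : ℝ) * alpha * piS (i, j)
      = ∑ x ∈ S.filter (fun s => s.1 ≤ i) ×ˢ S.filter (fun s => ¬ s.1 ≤ i),
          r x.1 x.2 * piS x.1 := by
    refine Finset.sum_of_injOn (fun j => ((i, j), (i + 1, j))) ?_ ?_ ?_ ?_
    · intro a _ b _ hab
      simpa using hab
    · intro j hj
      simp only [Finset.coe_Icc, Set.mem_Icc] at hj
      simp only [hS, Finset.coe_product, Set.mem_prod, Finset.mem_coe, Finset.mem_filter,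
        Finset.mem_product, Finset.mem_Icc]
      omega
    · rintro ⟨⟨a, b⟩, ⟨c, d⟩⟩ hx hne
      simp only [hS, Finset.mem_product, Finset.mem_filter, Finset.mem_Icc] at hx
      have hne' : ¬ (a = i ∧ c = i + 1 ∧ d = b ∧ n₀ + i + 1 ≤ b) := by
        rintro ⟨rfl, rfl, rfl, hb⟩
        exact hne ⟨d, by simp only [Finset.coe_Icc, Set.mem_Icc]; omega, rfl⟩
      simp only [hr]
      rw [if_neg (by omega), if_neg (by omega), if_neg (by omega), if_neg (by omega),
        if_neg (by omega)]
      simp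
    · intro j hj
      simp only [Finset.mem_Icc] at hj
      simp only [hr]
      rw [if_neg (by omega), if_neg (by omega), if_neg (by omega), if_neg (by omega),
        if_pos ⟨hi, hik, trivial, trivial, hj.1⟩]
      ring
  have hdown : ∑ x ∈ S.filter (fun s => s.1 ≤ i) ×ˢ S.filter (fun s => ¬ s.1 ≤ i),
      r x.2 x.1 * piS x.2 = ((n₀ + i + 1 : ℤ) : ℝ) * mu * piS (i + 1, n₀ + i + 1) := by
    rw [Finset.sum_eq_single_of_mem ((i, n₀ + i), (i + 1, n₀ + i + 1))]
    · simp only [hr]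
      rw [if_neg (by omega), if_neg (by omega), if_neg (by omega), if_pos (by omega),
        if_neg (by omega)]
      push_cast
      ring
    · simp only [hS, Finset.mem_filter, Finset.mem_product, Finset.mem_Icc]
      omega
    · rintro ⟨⟨a, b⟩, ⟨c, d⟩⟩ hx hne
      simp only [hS, Finset.mem_product, Finset.mem_filter, Finset.mem_Icc] at hx
      simp only [ne_eq, Prod.mk.injEq] at hne
      simp only [hr]
      rw [if_neg (by omega), if_neg (by omega), if_neg (by omega), if_neg (by omega),
        if_neg (by omega)]
      simp
  rw [hup, ← hdown]
  exact hcut.symm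
end

section
/- Fix real numbers λ, μ, α > 0 and integers n₀ ≥ 1, k ≥ 1, N = n₀ + k, K ≥ N. Define b⁰(K) = λ/(n₀·μ + (N−n₀)·α) and backward for j = K−1, K−2, …, n₀+1: b⁰(j) = λ/(λ + n₀·μ + min(j−n₀, N−n₀)·α − n₀·μ·b⁰(j+1)). Then all these quantities are well defined (each denominator is positive), 0 < b⁰(K) ≤ λ/(n₀·μ + min(K−n₀, N−n₀)·α), and for every j with n₀+1 ≤ j ≤ K−1 one has 0 < b⁰(j) < λ/(n₀·μ + min(j−n₀, N−n₀)·α); in particular every denominator λ + n₀·μ + min(j−n₀, N−n₀)·α − n₀·μ·b⁰(j+1) exceeds n₀·μ + min(j−n₀, N−n₀)·α > 0. -/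
/-- If `x ≤ l / (a + c)` with `a, c, l > 0`, then `a * x < l`. -/
theorem mul_lt_of_le_div_add {a c l x : ℝ} (ha : 0 < a) (hc : 0 < c) (hl : 0 < l)
    (hx : x ≤ l / (a + c)) : a * x < l := by
  rw [le_div_iff₀ (by positivity)] at hx
  rcases le_or_gt x 0 with h | h
  · nlinarith
  · nlinarith [mul_pos h hc]

/-- One step of the backward recursion: if `a * y < l`, then `l / (l + a + c - a * y)` is
positive and less than `l / (a + c)`. -/
theorem recursion_step_bounds {a c l y : ℝ} (ha : 0 < a) (hc : 0 < c) (hl : 0 < l)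
    (hy : a * y < l) :
    0 < l / (l + a + c - a * y) ∧ l / (l + a + c - a * y) < l / (a + c) :=
  ⟨div_pos hl (by linarith), div_lt_div_of_pos_left hl (by positivity) (by linarith)⟩

/-- Level-0 analogue of Corollary 1: the coefficients `b⁰ j` of the level-0
backward recursion are well defined (every denominator is positive, indeed
exceeds `n₀·μ + min(j−n₀, N−n₀)·α > 0`) and satisfy
`0 < b⁰ K ≤ λ/(n₀·μ + min(K−n₀, N−n₀)·α)` and
`0 < b⁰ j < λ/(n₀·μ + min(j−n₀, N−n₀)·α)` for `n₀+1 ≤ j ≤ K−1`. -/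
theorem level0_coefficients_bounds
    (lam mu alpha : ℝ) (hlam : 0 < lam) (hmu : 0 < mu) (halpha : 0 < alpha)
    (n₀ k N K : ℤ) (hn₀ : 1 ≤ n₀) (hk : 1 ≤ k) (hN : N = n₀ + k) (hK : N ≤ K)
    (b0 : ℤ → ℝ)
    -- definition of b⁰(K)
    (hbK : b0 K = lam / ((n₀ : ℝ) * mu + ((N - n₀ : ℤ) : ℝ) * alpha))
    -- the backward recursion
    (hbrec : ∀ j : ℤ, n₀ + 1 ≤ j → j ≤ K - 1 →
      b0 j = lam / (lam + (n₀ : ℝ) * mu + (min (j - n₀) (N - n₀) : ℝ) * alpha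
        - (n₀ : ℝ) * mu * b0 (j + 1))) :
    -- bounds at j = K
    (0 < b0 K ∧ b0 K ≤ lam / ((n₀ : ℝ) * mu + (min (K - n₀) (N - n₀) : ℝ) * alpha))
    ∧
    -- bounds for n₀+1 ≤ j ≤ K−1, including positivity of the denominators
    (∀ j : ℤ, n₀ + 1 ≤ j → j ≤ K - 1 →
      (0 < (n₀ : ℝ) * mu + (min (j - n₀) (N - n₀) : ℝ) * alpha) ∧
      ((n₀ : ℝ) * mu + (min (j - n₀) (N - n₀) : ℝ) * alpha
        < lam + (n₀ : ℝ) * mu + (min (j - n₀) (N - n₀) : ℝ) * alpha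
            - (n₀ : ℝ) * mu * b0 (j + 1)) ∧
      (0 < b0 j) ∧
      (b0 j < lam / ((n₀ : ℝ) * mu + (min (j - n₀) (N - n₀) : ℝ) * alpha))) := by
  have ha : 0 < (n₀ : ℝ) * mu := mul_pos (by exact_mod_cast hn₀) hmu
  have hc : ∀ j : ℤ, n₀ + 1 ≤ j → 0 < (min (j - n₀) (N - n₀) : ℝ) * alpha := by
    intro j hj
    have h₁ : (n₀ : ℝ) + 1 ≤ j := by exact_mod_cast hj
    have h₂ : (n₀ : ℝ) + 1 ≤ N := by exact_mod_cast (by lia : n₀ + 1 ≤ N)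
    exact mul_pos (lt_min (by linarith) (by linarith)) halpha
  have hcK := hc K (by lia)
  have hbK' : b0 K = lam / ((n₀ : ℝ) * mu + (min (K - n₀) (N - n₀) : ℝ) * alpha) := by
    have h : (N : ℝ) ≤ K := by exact_mod_cast hK
    rw [hbK, min_eq_right (by linarith)]
    push_cast
    rfl
  have key : ∀ m : ℤ, m ≤ K → n₀ + 1 ≤ m → (n₀ : ℝ) * mu * b0 m < lam := by
    intro m hm
    induction m, hm using Int.leInductionDown with
    | base => exact fun _ => mul_lt_of_le_div_add ha hcK hlam hbK'.le
    | pred m hm ih =>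
      intro h
      have hy := ih (by lia)
      have hb := hbrec (m - 1) h (by lia)
      rw [sub_add_cancel] at hb
      refine mul_lt_of_le_div_add ha (hc (m - 1) h) hlam ?_
      rw [hb]
      exact (recursion_step_bounds ha (hc (m - 1) h) hlam hy).2.le
  refine ⟨⟨hbK' ▸ div_pos hlam (by linarith), hbK'.le⟩, fun j hj hjK => ?_⟩
  have hcj := hc j hj
  have hy := key (j + 1) (by lia) (by lia)
  have hb := recursion_step_bounds ha hcj hlam hy
  rw [← hbrec j hj hjK] at hb
  exact ⟨by linarith, by linarith, hb.1, hb.2⟩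
end
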